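/- (Lower bound.) Let (ε_N)_N be a positive sequence vanishing at infinity and assume μ⁰_N converges narrowly to μ⁰ in P(ℝ^d). If (Q_N)_N converges narrowly to Q_∞ in P(Γ), then J(Q_∞) ≤ liminf_{N→∞} J_{ε_N}(Q_N). -/

import Mathlib

open MeasureTheory Filter Topology Set
open scoped ENNReal NNReal

noncomputable section

abbrev Euc (d : ℕ) : Type := EuclideanSpace ℝ (Fin d)

abbrev Traj (d : ℕ) (T : ℝ) : Type := C(Set.Icc (0:ℝ) T, Euc d)

instance (d : ℕ) (T : ℝ) : MeasurableSpace (Traj d T) := borel _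
instance (d : ℕ) (T : ℝ) : BorelSpace (Traj d T) := ⟨rfl⟩

/-- evaluation of a trajectory at time `t ∈ ℝ` (projected onto `[0,T]`). -/
def evalAt {d : ℕ} {T : ℝ} (hT : 0 ≤ T) (t : ℝ) (γ : Traj d T) : Euc d :=
  γ (Set.projIcc 0 T hT t)

/-- Narrow convergence of a sequence of measures. -/
def NarrowTendsto {X : Type*} [TopologicalSpace X] [MeasurableSpace X]
    (μ : ℕ → Measure X) (ν : Measure X) : Prop :=
  ∀ f : BoundedContinuousFunction X ℝ,
    Tendsto (fun n => ∫ x, f x ∂(μ n)) atTop (𝓝 (∫ x, f x ∂ν))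

/-- Squared 2-Wasserstein distance. -/
def W2sq {X : Type*} [MeasurableSpace X] [PseudoMetricSpace X]
    (μ ν : Measure X) : ℝ≥0∞ :=
  ⨅ (π : Measure (X × X)) (_ : π.map Prod.fst = μ ∧ π.map Prod.snd = ν),
    ∫⁻ p, ENNReal.ofReal (dist p.1 p.2 ^ 2) ∂π

/-- Uniform discrete probability measures on `N` points. -/
def IsUnifDiscrete {X : Type*} [MeasurableSpace X] (N : ℕ) (μ : Measure X) : Prop :=
  ∃ x : Fin N → X, μ = ((N : ℝ≥0∞))⁻¹ • ∑ i, MeasureTheory.Measure.dirac (x i)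

/-- Shifted (by `+C`) kinetic action: equals `∫₀ᵀ (L(γ'(t)) + C) dt` if `γ ∈ W^{1,r}`,
`+∞` otherwise. -/
def actionN {d : ℕ} {T : ℝ} (L : Euc d → ℝ) (C : ℝ) (γ : Traj d T) : ℝ≥0∞ :=
  sInf { a : ℝ≥0∞ | ∃ g : ℝ → Euc d, IntervalIntegrable g volume 0 T ∧
      (∀ s t : Set.Icc (0:ℝ) T, γ t - γ s = ∫ u in (s:ℝ)..(t:ℝ), g u) ∧
      a = ∫⁻ t in Set.Ioc (0:ℝ) T, ENNReal.ofReal (L (g t) + C) }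

/-- Kinetic part of the energy: `∫_Γ L(γ) dQ(γ)`. -/
def kinE {d : ℕ} {T : ℝ} (L : Euc d → ℝ) (C : ℝ) (Q : Measure (Traj d T)) : EReal :=
  ((∫⁻ γ, actionN L C γ ∂Q : ℝ≥0∞) : EReal) - ((C * T : ℝ) : EReal)

/-- The mean-field game energy `J`. -/
def Jfun {d : ℕ} {T : ℝ} (hT : 0 ≤ T) (L : Euc d → ℝ) (C : ℝ)
    (F : Measure (Euc d) → ℝ≥0∞) (G : Measure (Traj d T) → ℝ)
    (Q : Measure (Traj d T)) : EReal :=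
  kinE L C Q
    + ((∫⁻ t in Set.Ioc (0:ℝ) T, F (Q.map (evalAt hT t)) : ℝ≥0∞) : EReal)
    + ((G Q : ℝ) : EReal)

/-- Moreau envelope of `F` with parameter `ε` in the 2-Wasserstein space. -/
def moreau {d : ℕ} (Ω : Set (Euc d)) (F : Measure (Euc d) → ℝ≥0∞) (ε : ℝ)
    (μ : Measure (Euc d)) : ℝ≥0∞ :=
  ⨅ (ρ : Measure (Euc d)) (_ : IsProbabilityMeasure ρ ∧ ρ Ωᶜ = 0),
    W2sq μ ρ / ENNReal.ofReal (2 * ε) + F ρ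

/-- The regularized energy `J_ε`. -/
def Jeps {d : ℕ} {T : ℝ} (hT : 0 ≤ T) (Ω : Set (Euc d)) (L : Euc d → ℝ) (C : ℝ)
    (F : Measure (Euc d) → ℝ≥0∞) (G : Measure (Traj d T) → ℝ) (ε : ℝ)
    (Q : Measure (Traj d T)) : EReal :=
  kinE L C Q
    + ((∫⁻ t in Set.Ioc (0:ℝ) T, moreau Ω F ε (Q.map (evalAt hT t)) : ℝ≥0∞) : EReal)
    + ((G Q : ℝ) : EReal)

end

open AbsolutelyContinuousOnInterval in
/-- Discrete action over disjoint families of intervals. -/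
noncomputable def discS {d : ℕ} (T : ℝ) (L : Euc d → ℝ) (C : ℝ) (f : ℝ → Euc d) : ℝ≥0∞ :=
  ⨆ (E : ℕ × (ℕ → ℝ × ℝ)) (_ : E ∈ disjWithin 0 T), ∑ i ∈ Finset.range E.1,
    ENNReal.ofReal (dist (E.2 i).1 (E.2 i).2 * (L (slope f (E.2 i).1 (E.2 i).2) + C))

/-- Extension of a trajectory to the real line. -/
noncomputable def extT {d : ℕ} {T : ℝ} (hT : 0 ≤ T) (γ : Traj d T) : ℝ → Euc d := fun t => evalAt hT t γ

lemma extT_continuous {d : ℕ} {T : ℝ} (hT : 0 ≤ T) (t : ℝ) :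
    Continuous (fun γ : Traj d T => extT hT γ t) := by
  unfold extT evalAt
  exact continuous_eval_const _

lemma cell_le {d : ℕ} (L : Euc d → ℝ) (C : ℝ) (hLconv : ConvexOn ℝ Set.univ L)
    (hLcont : Continuous L) (hpos : ∀ p, 0 ≤ L p + C) (f g : ℝ → Euc d) (u v : ℝ) (huv : u < v)
    (hg : IntegrableOn g (Ioc u v)) (hfg : f v - f u = ∫ x in u..v, g x) :
    ENNReal.ofReal (dist u v * (L (slope f u v) + C)) ≤
      ∫⁻ t in Ioc u v, ENNReal.ofReal (L (g t) + C) := by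
  by_cases htop : ∫⁻ t in Ioc u v, ENNReal.ofReal (L (g t) + C) = ⊤
  · rw [htop]; exact le_top
  have hms : AEStronglyMeasurable (fun t => L (g t) + C) (volume.restrict (Ioc u v)) :=
    (hLcont.comp_aestronglyMeasurable hg.aestronglyMeasurable).add_const C
  have hint : IntegrableOn (fun t => L (g t) + C) (Ioc u v) := by
    refine ⟨hms, ?_⟩
    rw [hasFiniteIntegral_iff_ofReal (Eventually.of_forall fun t => hpos _)]
    exact lt_top_iff_ne_top.2 htop
  have hc : ConvexOn ℝ Set.univ (fun p => L p + C) := hLconv.add (convexOn_const C convex_univ)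
  have hvol : volume (Ioc u v) = ENNReal.ofReal (v - u) := Real.volume_Ioc
  have key := hc.map_set_average_le (μ := volume) (t := Ioc u v) (f := g)
    (by fun_prop) isClosed_univ (by rw [hvol]; simp [huv]) (by rw [hvol]; simp)
    (by simp) hg hint
  rw [← ofReal_integral_eq_lintegral_ofReal hint (Eventually.of_forall fun t => hpos _)]
  apply ENNReal.ofReal_le_ofReal
  have hreal : volume.real (Ioc u v) = v - u := by
    rw [Measure.real, hvol, ENNReal.toReal_ofReal (by linarith)]
  rw [setAverage_eq, setAverage_eq, hreal, ← intervalIntegral.integral_of_le huv.le, ← hfg] at key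
  have hd : dist u v = v - u := by rw [Real.dist_eq, abs_sub_comm, abs_of_pos (by linarith)]
  rw [hd]
  have hs : slope f u v = (v - u)⁻¹ • (f v - f u) := rfl
  rw [hs]
  have h0 : 0 < v - u := by linarith
  calc (v - u) * (L ((v - u)⁻¹ • (f v - f u)) + C)
      ≤ (v - u) * ((v - u)⁻¹ • ∫ x in Ioc u v, (L (g x) + C)) := by gcongr
    _ = _ := by rw [smul_eq_mul, mul_inv_cancel_left₀ h0.ne']

lemma cell_le' {d : ℕ} (L : Euc d → ℝ) (C : ℝ) (hLconv : ConvexOn ℝ Set.univ L)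
    (hLcont : Continuous L) (hpos : ∀ p, 0 ≤ L p + C) (f g : ℝ → Euc d) (u v : ℝ)
    (hg : IntegrableOn g (uIoc u v)) (hfg : f v - f u = ∫ x in u..v, g x) :
    ENNReal.ofReal (dist u v * (L (slope f u v) + C)) ≤
      ∫⁻ t in uIoc u v, ENNReal.ofReal (L (g t) + C) := by
  rcases lt_trichotomy u v with h | h | h
  · rw [uIoc_of_le h.le] at hg ⊢
    exact cell_le L C hLconv hLcont hpos f g u v h hg hfg
  · subst h; simp
  · rw [uIoc_comm, uIoc_of_le h.le] at hg ⊢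
    rw [dist_comm, slope_comm]
    refine cell_le L C hLconv hLcont hpos f g v u h hg ?_
    rw [intervalIntegral.integral_symm, ← hfg]; abel

lemma discS_le_actionN {d : ℕ} {T : ℝ} (hT : 0 ≤ T) (L : Euc d → ℝ) (C : ℝ)
    (hLconv : ConvexOn ℝ Set.univ L)
    (hLcont : Continuous L) (hpos : ∀ p, 0 ≤ L p + C) (γ : Traj d T) :
    discS T L C (extT hT γ) ≤ actionN L C γ := by
  unfold actionN
  refine le_sInf ?_
  rintro a ⟨g, hgi, hg, rfl⟩
  refine iSup₂_le ?_
  rintro ⟨n, I⟩ hE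
  have hsub := fun i (hi : i < n) => AbsolutelyContinuousOnInterval.uIoc_subset_of_mem_disjWithin hE hi
  have hbu := AbsolutelyContinuousOnInterval.biUnion_uIoc_subset_of_mem_disjWithin hE
  have hgi' : IntegrableOn g (uIoc 0 T) := by
    rw [intervalIntegrable_iff] at hgi; exact hgi
  obtain ⟨h1, h2⟩ := hE
  simp only at h1 h2 ⊢
  calc _ ≤ ∑ i ∈ Finset.range n, ∫⁻ t in uIoc (I i).1 (I i).2, ENNReal.ofReal (L (g t) + C) := by
        refine Finset.sum_le_sum fun i hi => ?_
        refine cell_le' L C hLconv hLcont hpos _ g _ _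
          (hgi'.mono_set (hsub i (Finset.mem_range.1 hi))) ?_
        have hu := (h1 i hi).1
        have hv := (h1 i hi).2
        rw [uIcc_of_le hT] at hu hv
        have := hg ⟨_, hu⟩ ⟨_, hv⟩
        simp only at this
        rw [← this]
        simp [extT, evalAt, projIcc_of_mem hT hu, projIcc_of_mem hT hv]
    _ = ∫⁻ t in ⋃ i ∈ Finset.range n, uIoc (I i).1 (I i).2, ENNReal.ofReal (L (g t) + C) :=
        (lintegral_biUnion_finset h2 (fun i _ => measurableSet_uIoc) _).symm
    _ ≤ ∫⁻ t in uIoc 0 T, ENNReal.ofReal (L (g t) + C) := lintegral_mono_set hbu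
    _ = _ := by rw [uIoc_of_le hT]

lemma superlinear (r C : ℝ) (hr : 1 < r) (hC : 0 < C) (η : ℝ) (hη : 0 < η) :
    ∃ M : ℝ, 0 < M ∧ ∀ x : ℝ, 0 ≤ x → x ≤ η * (1 / (r * C) * x ^ r) + M := by
  have h1 : 0 < η * (1 / (r * C)) := by positivity
  set c := η * (1 / (r * C)) with hc
  -- for x ≥ M, c * x^(r-1) ≥ 1
  refine ⟨(1 / c) ^ (1 / (r - 1)), by positivity, fun x hx => ?_⟩
  set M := (1 / c) ^ (1 / (r - 1)) with hM
  have hMpos : 0 < M := by positivity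
  rw [← mul_assoc, ← hc]
  rcases le_or_gt x M with h | h
  · have : 0 ≤ c * x ^ r := by positivity
    linarith
  · have hx0 : 0 < x := hMpos.trans h
    have h2 : 1 / c ≤ x ^ (r - 1) := by
      have : M ^ (r - 1) = 1 / c := by
        rw [hM, ← Real.rpow_mul (by positivity), one_div_mul_cancel (by linarith), Real.rpow_one]
      rw [← this]
      exact Real.rpow_le_rpow hMpos.le h.le (by linarith)
    have h3 : x ^ r = x ^ (r - 1) * x := by
      rw [← Real.rpow_add_one hx0.ne']; ring_nf
    have h4 : 1 ≤ c * x ^ (r - 1) := by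
      rw [div_le_iff₀ h1] at h2; linarith
    rw [h3, ← mul_assoc]
    nlinarith

lemma ac_of_discS {d : ℕ} {T : ℝ} (L : Euc d → ℝ) (r C : ℝ) (hr : 1 < r) (hC : 0 < C)
    (hL : ∀ p : Euc d, 1 / (r * C) * ‖p‖ ^ r ≤ L p + C) (f : ℝ → Euc d)
    (hS : discS T L C f ≠ ⊤) : AbsolutelyContinuousOnInterval f 0 T := by
  rw [absolutelyContinuousOnInterval_iff]
  intro e he
  have hS0 : 0 ≤ (discS T L C f).toReal := ENNReal.toReal_nonneg
  set S := (discS T L C f).toReal with hSdef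
  obtain ⟨M, hM, hsup⟩ := superlinear r C hr hC (e / (2 * (S + 1))) (by positivity)
  refine ⟨e / (2 * M), by positivity, ?_⟩
  rintro ⟨n, I⟩ hE hlen
  simp only at hlen ⊢
  have hpos : ∀ p, 0 ≤ L p + C := fun p => le_trans (by positivity) (hL p)
  have hsum : ∑ i ∈ Finset.range n, dist (I i).1 (I i).2 * (L (slope f (I i).1 (I i).2) + C) ≤ S := by
    have := le_iSup₂_of_le (f := fun (E : ℕ × (ℕ → ℝ × ℝ))
      (_ : E ∈ AbsolutelyContinuousOnInterval.disjWithin 0 T) => ∑ i ∈ Finset.range E.1,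
      ENNReal.ofReal (dist (E.2 i).1 (E.2 i).2 * (L (slope f (E.2 i).1 (E.2 i).2) + C)))
      (n, I) hE le_rfl
    rw [← ENNReal.ofReal_sum_of_nonneg (fun i _ => mul_nonneg dist_nonneg (hpos _))] at this
    exact (ENNReal.ofReal_le_iff_le_toReal hS).1 this
  have hterm : ∀ i, dist (f (I i).1) (f (I i).2) ≤
      e / (2 * (S + 1)) * (dist (I i).1 (I i).2 * (L (slope f (I i).1 (I i).2) + C))
        + M * dist (I i).1 (I i).2 := by
    intro i
    have h1 : dist (f (I i).1) (f (I i).2) = dist (I i).1 (I i).2 * ‖slope f (I i).1 (I i).2‖ := by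
      have := sub_smul_slope f (I i).1 (I i).2
      rw [dist_comm, dist_comm (I i).1, dist_eq_norm, dist_eq_norm, ← norm_smul, this]; rfl
    have h2 := hsup ‖slope f (I i).1 (I i).2‖ (norm_nonneg _)
    have h3 := hL (slope f (I i).1 (I i).2)
    have h4 : ‖slope f (I i).1 (I i).2‖ ≤ e / (2 * (S + 1)) * (L (slope f (I i).1 (I i).2) + C) + M := by
      refine h2.trans ?_
      gcongr
    rw [h1]
    calc _ ≤ dist (I i).1 (I i).2 * (e / (2 * (S + 1)) * (L (slope f (I i).1 (I i).2) + C) + M) := by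
          gcongr
      _ = _ := by ring
  calc _ ≤ ∑ i ∈ Finset.range n, (e / (2 * (S + 1)) * (dist (I i).1 (I i).2 * (L (slope f (I i).1 (I i).2) + C))
        + M * dist (I i).1 (I i).2) := Finset.sum_le_sum fun i _ => hterm i
    _ = e / (2 * (S + 1)) * (∑ i ∈ Finset.range n, dist (I i).1 (I i).2 * (L (slope f (I i).1 (I i).2) + C))
        + M * ∑ i ∈ Finset.range n, dist (I i).1 (I i).2 := by
        rw [Finset.sum_add_distrib, Finset.mul_sum, Finset.mul_sum]
    _ ≤ e / (2 * (S + 1)) * (S + 1) + M * ∑ i ∈ Finset.range n, dist (I i).1 (I i).2 := by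
        gcongr; linarith
    _ < e / (2 * (S + 1)) * (S + 1) + M * (e / (2 * M)) := by gcongr
    _ = e := by field_simp; ring

lemma discS_lsc {d : ℕ} {T : ℝ} (hT : 0 ≤ T) (L : Euc d → ℝ) (C : ℝ) (hLcont : Continuous L) :
    LowerSemicontinuous (fun γ : Traj d T => discS T L C (extT hT γ)) := by
  unfold discS
  refine lowerSemicontinuous_iSup fun E => lowerSemicontinuous_iSup fun hE => ?_
  refine Continuous.lowerSemicontinuous ?_
  refine continuous_finsetSum _ fun i _ => ?_
  refine ENNReal.continuous_ofReal.comp ?_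
  have h1 := extT_continuous (d := d) hT (E.2 i).1
  have h2 := extT_continuous (d := d) hT (E.2 i).2
  simp only [slope, vsub_eq_sub]
  fun_prop

lemma straddle {V : Type*} [NormedAddCommGroup V] [NormedSpace ℝ V] (f : ℝ → V) (f' : V) (t : ℝ)
    (hf : HasDerivAt f f' t) (a b : ℕ → ℝ) (ha : Tendsto a atTop (𝓝 t)) (hb : Tendsto b atTop (𝓝 t))
    (hat : ∀ n, a n ≤ t) (htb : ∀ n, t ≤ b n) (hab : ∀ᶠ n in atTop, a n < b n) :
    Tendsto (fun n => slope f (a n) (b n)) atTop (𝓝 f') := by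
  rw [hasDerivAt_iff_isLittleO] at hf
  rw [Metric.tendsto_nhds]
  intro e he
  have h := hf.def (half_pos he)
  filter_upwards [ha.eventually h, hb.eventually h, hab] with n h1 h2 h3
  have hpos : 0 < b n - a n := by linarith
  rw [dist_eq_norm]
  have heq : slope f (a n) (b n) - f' = (b n - a n)⁻¹ •
      ((f (b n) - f t - (b n - t) • f') - (f (a n) - f t - (a n - t) • f')) := by
    have hs : slope f (a n) (b n) = (b n - a n)⁻¹ • (f (b n) - f (a n)) := rfl
    have : f' = (b n - a n)⁻¹ • ((b n - a n) • f') := by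
      rw [smul_smul, inv_mul_cancel₀ hpos.ne', one_smul]
    rw [hs]; nth_rewrite 1 [this]; rw [← smul_sub]; congr 1; module
  rw [heq, norm_smul, norm_inv, Real.norm_of_nonneg hpos.le]
  have h4 : ‖(f (b n) - f t - (b n - t) • f') - (f (a n) - f t - (a n - t) • f')‖
      ≤ e / 2 * (b n - a n) := by
    refine (norm_sub_le _ _).trans ?_
    rw [Real.norm_eq_abs, abs_of_nonpos (by linarith [hat n])] at h1
    rw [Real.norm_eq_abs, abs_of_nonneg (by linarith [htb n])] at h2
    linarith
  calc _ ≤ (b n - a n)⁻¹ * (e / 2 * (b n - a n)) := by gcongr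
    _ = e / 2 := by field_simp
    _ < e := by linarith

lemma fatou_discS {d : ℕ} {T : ℝ} (hT : 0 < T) (L : Euc d → ℝ) (C : ℝ) (hLcont : Continuous L)
    (f : ℝ → Euc d)
    (hd : ∀ᵐ t, t ∈ uIcc 0 T → DifferentiableAt ℝ f t) :
    ∫⁻ t in Ioc 0 T, ENNReal.ofReal (L (deriv f t) + C) ≤ discS T L C f := by
  -- mesh
  let h : ℕ → ℝ := fun n => T / (n + 1)
  have hh : ∀ n, 0 < h n := fun n => by positivity
  have hh0 : Tendsto h atTop (𝓝 0) := tendsto_const_div_atTop_nhds_zero_nat T |>.comp (tendsto_add_atTop_nat 1) |>.congr (fun n => by simp [h])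
  let k : ℕ → ℝ → ℤ := fun n t => ⌈t / h n⌉
  let a : ℕ → ℝ → ℝ := fun n t => ((k n t : ℝ) - 1) * h n
  let b : ℕ → ℝ → ℝ := fun n t => (k n t : ℝ) * h n
  have hb : ∀ n t, t ≤ b n t := fun n t => by
    have := Int.le_ceil (t / h n)
    rwa [div_le_iff₀ (hh n)] at this
  have ha : ∀ n t, a n t ≤ t := fun n t => by
    have := (Int.ceil_lt_add_one (t / h n)).le
    rw [← sub_le_iff_le_add, le_div_iff₀ (hh n)] at this
    exact this
  have hba : ∀ n t, b n t = a n t + h n := fun n t => by simp only [a, b]; ring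
  let G : ℕ → ℝ → ℝ≥0∞ := fun n t => ENNReal.ofReal (L (slope f (a n t) (b n t)) + C)
  have hGm : ∀ n, Measurable (G n) := fun n => by
    have : G n = (fun j : ℤ => ENNReal.ofReal (L (slope f (((j : ℝ) - 1) * h n) ((j : ℝ) * h n)) + C)) ∘ (k n) := rfl
    rw [this]
    exact (measurable_from_top).comp (Int.measurable_ceil.comp (measurable_id.div_const _))
  have hlim : ∀ᵐ t ∂(volume.restrict (Ioc 0 T)), ENNReal.ofReal (L (deriv f t) + C) ≤ liminf (fun n => G n t) atTop := by
    rw [ae_restrict_iff' measurableSet_Ioc]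
    filter_upwards [hd] with t ht htm
    rw [uIcc_of_le hT.le] at ht
    have hdt := (ht ⟨htm.1.le, htm.2⟩).hasDerivAt
    have hat : Tendsto (fun n => a n t) atTop (𝓝 t) := by
      refine tendsto_of_tendsto_of_tendsto_of_le_of_le (g := fun n => t - h n) (h := fun _ => t) ?_ tendsto_const_nhds ?_ ?_
      · simpa using tendsto_const_nhds.sub hh0
      · intro n; have := hb n t; rw [hba] at this; simp only; linarith
      · intro n; exact ha n t
    have hbt : Tendsto (fun n => b n t) atTop (𝓝 t) := by
      simp_rw [hba]; simpa using hat.add hh0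
    have := straddle f _ t hdt (fun n => a n t) (fun n => b n t) hat hbt (fun n => ha n t) (fun n => hb n t)
      (Eventually.of_forall fun n => by have := hh n; have := hba n t; linarith)
    have h2 : Tendsto (fun n => G n t) atTop (𝓝 (ENNReal.ofReal (L (deriv f t) + C))) :=
      (ENNReal.continuous_ofReal.tendsto _).comp (((hLcont.tendsto _).comp this).add_const C)
    exact h2.liminf_eq.ge
  have hbound : ∀ n, ∫⁻ t in Ioc 0 T, G n t ≤ discS T L C f := by
    intro n
    let I : ℕ → ℝ × ℝ := fun i => ((i : ℝ) * h n, ((i : ℝ) + 1) * h n)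
    have hle : ∀ i, (I i).1 ≤ (I i).2 := fun i => by simp only [I]; have := hh n; nlinarith
    have hnT : ((n : ℝ) + 1) * h n = T := by simp only [h]; field_simp
    have hE : (n + 1, I) ∈ AbsolutelyContinuousOnInterval.disjWithin 0 T := by
      refine ⟨?_, ?_⟩
      · intro i hi
        simp only [Finset.mem_range] at hi
        have hi' : (i : ℝ) + 1 ≤ n + 1 := by exact_mod_cast hi
        have h5 : ((i : ℝ) + 1) * h n ≤ T := by rw [← hnT]; have := hh n; gcongr
        have h6 : 0 ≤ (i : ℝ) * h n := by have := hh n; positivity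
        have h7 := hle i
        rw [uIcc_of_le hT.le]
        simp only [I, mem_Icc] at h7 ⊢
        refine ⟨⟨?_, ?_⟩, ?_, ?_⟩ <;> linarith
      · intro i _ j _ hij
        simp only [Function.onFun]
        rw [uIoc_of_le (hle i), uIoc_of_le (hle j), Set.disjoint_left]
        rintro x ⟨h1, h2⟩ ⟨h3, h4⟩
        simp only [I] at h1 h2 h3 h4
        have hh' := hh n
        have q1 : (i : ℝ) < j + 1 := lt_of_mul_lt_mul_right (h1.trans_le h4) hh'.le
        have q2 : (j : ℝ) < i + 1 := lt_of_mul_lt_mul_right (h3.trans_le h2) hh'.le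
        have q3 : i < j + 1 := by exact_mod_cast q1
        have q4 : j < i + 1 := by exact_mod_cast q2
        omega
    have hcov : Ioc 0 T ⊆ ⋃ i ∈ Finset.range (n + 1), Ioc (I i).1 (I i).2 := by
      intro x hx
      have hk : 0 < ⌈x / h n⌉ := Int.ceil_pos.2 (div_pos hx.1 (hh n))
      have hk2 : ⌈x / h n⌉ ≤ (n : ℤ) + 1 := by
        rw [Int.ceil_le, div_le_iff₀ (hh n)]; push_cast; rw [hnT]; exact hx.2
      obtain ⟨m, hm⟩ : ∃ m : ℕ, ⌈x / h n⌉ = (m : ℤ) + 1 := ⟨(⌈x / h n⌉ - 1).toNat, by omega⟩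
      simp only [mem_iUnion, Finset.mem_range]
      refine ⟨m, by omega, ?_, ?_⟩
      · have := Int.ceil_lt_add_one (x / h n)
        rw [hm] at this; push_cast at this
        have h8 : (m : ℝ) < x / h n := by linarith
        rwa [lt_div_iff₀ (hh n)] at h8
      · have := Int.le_ceil (x / h n)
        rw [hm] at this; push_cast at this
        rwa [div_le_iff₀ (hh n)] at this
    calc ∫⁻ t in Ioc 0 T, G n t ≤ ∫⁻ t in ⋃ i ∈ Finset.range (n + 1), Ioc (I i).1 (I i).2, G n t :=
          lintegral_mono_set hcov
      _ = ∑ i ∈ Finset.range (n + 1), ∫⁻ t in Ioc (I i).1 (I i).2, G n t := by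
          refine lintegral_biUnion_finset ?_ (fun i _ => measurableSet_Ioc) _
          have := hE.2
          intro i hi j hj hij
          have h9 := this hi hj hij
          simp only [Function.onFun] at h9 ⊢
          rwa [uIoc_of_le (hle i), uIoc_of_le (hle j)] at h9
      _ = ∑ i ∈ Finset.range (n + 1), ENNReal.ofReal (dist (I i).1 (I i).2 * (L (slope f (I i).1 (I i).2) + C)) := by
          refine Finset.sum_congr rfl fun i _ => ?_
          have hconst : ∀ t ∈ Ioc (I i).1 (I i).2, G n t = ENNReal.ofReal (L (slope f (I i).1 (I i).2) + C) := by
            intro t ht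
            have hc : k n t = (i : ℤ) + 1 := by
              simp only [k]
              rw [Int.ceil_eq_iff]
              push_cast
              refine ⟨?_, ?_⟩
              · rw [lt_div_iff₀ (hh n)]; simpa [I] using ht.1
              · rw [div_le_iff₀ (hh n)]; simpa [I] using ht.2
            simp only [G, a, b, hc, I]
            push_cast
            simp
          rw [setLIntegral_congr_fun measurableSet_Ioc hconst, setLIntegral_const, Real.volume_Ioc]
          have hdist : dist (I i).1 (I i).2 = (I i).2 - (I i).1 := by
            rw [Real.dist_eq, abs_sub_comm, abs_of_nonneg (by linarith [hle i])]
          rw [hdist, mul_comm, ENNReal.ofReal_mul (by linarith [hle i])]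
      _ ≤ discS T L C f := le_iSup₂_of_le (f := fun (E : ℕ × (ℕ → ℝ × ℝ))
            (_ : E ∈ AbsolutelyContinuousOnInterval.disjWithin 0 T) => ∑ i ∈ Finset.range E.1,
            ENNReal.ofReal (dist (E.2 i).1 (E.2 i).2 * (L (slope f (E.2 i).1 (E.2 i).2) + C)))
            (n + 1, I) hE le_rfl
  calc _ ≤ ∫⁻ t in Ioc 0 T, liminf (fun n => G n t) atTop := lintegral_mono_ae hlim
    _ ≤ liminf (fun n => ∫⁻ t in Ioc 0 T, G n t) atTop := lintegral_liminf_le hGm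
    _ ≤ liminf (fun _ : ℕ => discS T L C f) atTop := liminf_le_liminf (Eventually.of_forall hbound)
    _ = _ := by simp

lemma ac_coord {d : ℕ} {a b : ℝ} {f : ℝ → Euc d} (hf : AbsolutelyContinuousOnInterval f a b)
    (i : Fin d) : AbsolutelyContinuousOnInterval (fun t => f t i) a b := by
  rw [absolutelyContinuousOnInterval_iff] at hf ⊢
  intro e he
  obtain ⟨δ, hδ, h⟩ := hf e he
  refine ⟨δ, hδ, fun E hE hl => lt_of_le_of_lt (Finset.sum_le_sum fun j _ => ?_) (h E hE hl)⟩
  rw [dist_eq_norm, dist_eq_norm]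
  exact PiLp.norm_apply_le (f (E.2 j).1 - f (E.2 j).2) i

lemma ac_ftc {d : ℕ} {a b : ℝ} {f : ℝ → Euc d} (hf : AbsolutelyContinuousOnInterval f a b) :
    IntervalIntegrable (deriv f) volume a b ∧ ∫ t in a..b, deriv f t = f b - f a := by
  have hd : ∀ᵐ t, t ∈ uIcc a b → DifferentiableAt ℝ f t :=
    hf.boundedVariationOn.ae_differentiableAt_of_mem_uIcc
  have hco : ∀ i : Fin d, ∀ᵐ t, t ∈ uIcc a b → deriv (fun t => f t i) t = deriv f t i := by
    intro i
    filter_upwards [hd] with t ht htm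
    have h1 := (ht htm).hasDerivAt
    have h2 := ((EuclideanSpace.proj (𝕜 := ℝ) i).hasFDerivAt.comp_hasDerivAt t h1)
    exact h2.deriv
  have hIi : ∀ i : Fin d, IntervalIntegrable (fun t => deriv f t i) volume a b := by
    intro i
    refine (ac_coord hf i).intervalIntegrable_deriv.congr_ae ?_
    rw [Filter.EventuallyEq, ae_restrict_iff' measurableSet_uIoc]
    filter_upwards [hco i] with t ht htm
    exact ht (uIoc_subset_uIcc htm)
  have hI : IntervalIntegrable (deriv f) volume a b := by
    rw [intervalIntegrable_iff]
    refine Integrable.of_eval_piLp (fun i => ?_)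
    have := hIi i
    rwa [intervalIntegrable_iff] at this
  refine ⟨hI, ?_⟩
  ext i
  have h1 := (EuclideanSpace.proj (𝕜 := ℝ) i : Euc d →L[ℝ] ℝ).intervalIntegral_comp_comm hI
  have h2 := (ac_coord hf i).integral_deriv_eq_sub
  have h3 : ∫ t in a..b, deriv (fun t => f t i) t = ∫ t in a..b, deriv f t i := by
    refine intervalIntegral.integral_congr_ae ?_
    filter_upwards [hco i] with t ht htm
    exact ht (uIoc_subset_uIcc htm)
  rw [h3] at h2
  change ∫ t in a..b, deriv f t i = (∫ t in a..b, deriv f t) i at h1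
  rw [← h1, h2]; rfl

lemma actionN_eq_discS {d : ℕ} {T : ℝ} (hT : 0 < T) (L : Euc d → ℝ) (r C : ℝ)
    (hr : 1 < r) (hC : 0 < C)
    (hLconv : ConvexOn ℝ Set.univ L) (hLcont : Continuous L)
    (hL : ∀ p : Euc d, 1 / (r * C) * ‖p‖ ^ r ≤ L p + C) (γ : Traj d T) :
    actionN L C γ = discS T L C (extT hT.le γ) := by
  have hpos : ∀ p, 0 ≤ L p + C := fun p => le_trans (by positivity) (hL p)
  refine le_antisymm ?_ (discS_le_actionN hT.le L C hLconv hLcont hpos γ)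
  by_cases hS : discS T L C (extT hT.le γ) = ⊤
  · rw [hS]; exact le_top
  have hac := ac_of_discS L r C hr hC hL _ hS
  refine le_trans (sInf_le ⟨deriv (extT hT.le γ), (ac_ftc hac).1, ?_, rfl⟩)
    (fatou_discS hT L C hLcont _ hac.boundedVariationOn.ae_differentiableAt_of_mem_uIcc)
  intro s t
  have hsub : uIcc (s : ℝ) t ⊆ uIcc 0 T := by
    rw [uIcc_of_le hT.le]; exact uIcc_subset_Icc s.2 t.2
  rw [(ac_ftc (hac.mono hsub)).2]
  simp [extT, evalAt]

lemma portm_lsc {X : Type*} [MeasurableSpace X] [TopologicalSpace X] [OpensMeasurableSpace X]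
    {μ : Measure X} {μs : ℕ → Measure X} {f : X → ℝ≥0∞} (hf : LowerSemicontinuous f)
    (h_opens : ∀ G, IsOpen G → μ G ≤ atTop.liminf (fun i ↦ μs i G)) :
    ∫⁻ x, f x ∂μ ≤ atTop.liminf (fun i ↦ ∫⁻ x, f x ∂(μs i)) := by
  have hfm : Measurable f := hf.measurable
  have hmono : f = fun x => ⨆ n : ℕ, min (f x) n := by
    funext x
    rw [← inf_iSup_eq]
    simp [ENNReal.iSup_natCast]
  have hmin : ∀ n : ℕ, ∫⁻ x, min (f x) n ∂μ ≤ atTop.liminf (fun i ↦ ∫⁻ x, f x ∂(μs i)) := by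
    intro n
    have hne : ∀ x, min (f x) n ≠ ⊤ := fun x => ne_top_of_le_ne_top (ENNReal.natCast_ne_top n) (min_le_right _ _)
    let g : X → ℝ := fun x => (min (f x) n).toReal
    have hg : ∀ x, ENNReal.ofReal (g x) = min (f x) n := fun x => ENNReal.ofReal_toReal (hne x)
    have hgm : Measurable g := (hfm.min measurable_const).ennreal_toReal
    have hlc := fun ν : Measure X => lintegral_eq_lintegral_meas_lt ν (f := g)
      (Eventually.of_forall fun x => ENNReal.toReal_nonneg) hgm.aemeasurable
    simp_rw [hg] at hlc
    have hopen : ∀ t : ℝ, IsOpen {x | t < g x} := by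
      intro t
      rcases lt_or_ge t 0 with ht | ht
      · have : {x | t < g x} = univ := eq_univ_of_forall fun x => ht.trans_le ENNReal.toReal_nonneg
        rw [this]; exact isOpen_univ
      · have : {x | t < g x} = f ⁻¹' Ioi (ENNReal.ofReal t) ∩ {x | ENNReal.ofReal t < n} := by
          ext x
          simp only [g, mem_ofPred_eq, mem_inter_iff, mem_preimage, mem_Ioi]
          rw [← ENNReal.ofReal_lt_iff_lt_toReal ht (hne x), lt_min_iff]
        rw [this]
        exact (hf.isOpen_preimage _).inter isOpen_const
    calc ∫⁻ x, min (f x) n ∂μ = ∫⁻ t in Set.Ioi 0, μ {a | t < g a} := hlc μ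
      _ ≤ ∫⁻ (t : ℝ) in Set.Ioi 0, atTop.liminf (fun i ↦ (μs i) {a | t < g a}) :=
          lintegral_mono fun t => h_opens _ (hopen t)
      _ ≤ atTop.liminf (fun i ↦ ∫⁻ (t : ℝ) in Set.Ioi 0, (μs i) {a | t < g a}) :=
          lintegral_liminf_le (fun n ↦ Antitone.measurable (fun s t hst ↦
            measure_mono (fun ω hω ↦ lt_of_le_of_lt hst hω)))
      _ ≤ _ := by
          refine liminf_le_liminf (Eventually.of_forall fun i => ?_)
          rw [← hlc]
          exact lintegral_mono fun x => min_le_left _ _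
  conv_lhs => rw [hmono]
  rw [lintegral_iSup (fun n => hfm.min measurable_const)
    (fun m n hmn x => min_le_min_left _ (by exact_mod_cast hmn))]
  exact iSup_le hmin

/-- Bundle a probability measure. -/
def toPM {X : Type*} [MeasurableSpace X] (μ : Measure X) (h : IsProbabilityMeasure μ) :
    ProbabilityMeasure X := ⟨μ, h⟩

lemma narrow_iff {X : Type*} [TopologicalSpace X] [MeasurableSpace X] [OpensMeasurableSpace X]
    (μ : ℕ → Measure X) (ν : Measure X) (hμ : ∀ n, IsProbabilityMeasure (μ n))
    (hν : IsProbabilityMeasure ν) :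
    NarrowTendsto μ ν ↔ Tendsto (fun n => toPM (μ n) (hμ n)) atTop (𝓝 (toPM ν hν)) := by
  rw [ProbabilityMeasure.tendsto_iff_forall_integral_tendsto]; rfl

lemma action_liminf {d : ℕ} {T : ℝ} (hT : 0 < T) (L : Euc d → ℝ) (r C : ℝ)
    (hr : 1 < r) (hC : 0 < C)
    (hLconv : ConvexOn ℝ Set.univ L) (hLcont : Continuous L)
    (hL : ∀ p : Euc d, 1 / (r * C) * ‖p‖ ^ r ≤ L p + C)
    (Q : ℕ → Measure (Traj d T)) (hQ : ∀ N, IsProbabilityMeasure (Q N))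
    (Qlim : Measure (Traj d T)) (hQlim : IsProbabilityMeasure Qlim)
    (hQcv : NarrowTendsto Q Qlim) :
    ∫⁻ γ, actionN L C γ ∂Qlim ≤ liminf (fun N => ∫⁻ γ, actionN L C γ ∂(Q N)) atTop := by
  have heq : (fun γ : Traj d T => actionN L C γ) = fun γ => discS T L C (extT hT.le γ) := by
    funext γ; exact actionN_eq_discS hT L r C hr hC hLconv hLcont hL γ
  refine portm_lsc (f := fun γ => actionN L C γ) ?_ ?_
  · rw [heq]; exact discS_lsc hT.le L C hLcont
  · intro G hG
    rw [narrow_iff Q Qlim hQ hQlim] at hQcv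
    exact ProbabilityMeasure.le_liminf_measure_open_of_tendsto hQcv hG

/-- Bounded-Lipschitz distance. -/
noncomputable def dBL {d : ℕ} (μ ρ : Measure (Euc d)) : ℝ≥0∞ :=
  ⨆ (f : Euc d → ℝ) (_ : LipschitzWith 1 f ∧ ∀ x, |f x| ≤ 1),
    ENNReal.ofReal |(∫ x, f x ∂μ) - ∫ x, f x ∂ρ|

lemma le_dBL {d : ℕ} (μ ρ : Measure (Euc d)) (f : Euc d → ℝ)
    (hf : LipschitzWith 1 f ∧ ∀ x, |f x| ≤ 1) :
    ENNReal.ofReal |(∫ x, f x ∂μ) - ∫ x, f x ∂ρ| ≤ dBL μ ρ :=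
  le_iSup₂_of_le (f := fun (f : Euc d → ℝ) (_ : LipschitzWith 1 f ∧ ∀ x, |f x| ≤ 1) =>
    ENNReal.ofReal |(∫ x, f x ∂μ) - ∫ x, f x ∂ρ|) f hf le_rfl

lemma dBL_triangle {d : ℕ} (μ ν ρ : Measure (Euc d)) : dBL μ ρ ≤ dBL μ ν + dBL ν ρ := by
  refine iSup₂_le fun f hf => ?_
  refine le_trans ?_ (add_le_add (le_dBL μ ν f hf) (le_dBL ν ρ f hf))
  rw [← ENNReal.ofReal_add (abs_nonneg _) (abs_nonneg _)]
  exact ENNReal.ofReal_le_ofReal (abs_sub_le _ _ _)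

lemma dBL_sq_le {d : ℕ} (μ ρ : Measure (Euc d)) (hμ : IsProbabilityMeasure μ) :
    dBL μ ρ ^ 2 ≤ W2sq μ ρ := by
  unfold W2sq
  refine le_iInf₂ ?_
  rintro π ⟨h1, h2⟩
  have hπ : IsProbabilityMeasure π := by
    constructor
    rw [← hμ.measure_univ, ← h1, Measure.map_apply measurable_fst MeasurableSet.univ]; simp
  unfold dBL
  rw [ENNReal.iSup_pow_of_ne_zero two_ne_zero]
  refine iSup_le fun f => ?_
  rw [ENNReal.iSup_pow_of_ne_zero two_ne_zero]
  refine iSup_le fun hf => ?_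
  have hfm : Measurable f := hf.1.continuous.measurable
  have e1 : ∫ x, f x ∂μ = ∫ p, f p.1 ∂π := by
    rw [← h1, integral_map measurable_fst.aemeasurable hfm.aestronglyMeasurable]
  have e2 : ∫ x, f x ∂ρ = ∫ p, f p.2 ∂π := by
    rw [← h2, integral_map measurable_snd.aemeasurable hfm.aestronglyMeasurable]
  have m1 : Measurable (fun p : Euc d × Euc d => f p.1) := hfm.comp measurable_fst
  have m2 : Measurable (fun p : Euc d × Euc d => f p.2) := hfm.comp measurable_snd
  have i1 : Integrable (fun p : Euc d × Euc d => f p.1) π :=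
    Integrable.of_bound m1.aestronglyMeasurable 1 (Eventually.of_forall fun p => hf.2 _)
  have i2 : Integrable (fun p : Euc d × Euc d => f p.2) π :=
    Integrable.of_bound m2.aestronglyMeasurable 1 (Eventually.of_forall fun p => hf.2 _)
  have i3 : Integrable (fun p : Euc d × Euc d => (f p.1 - f p.2) ^ 2) π := by
    refine Integrable.of_bound ((m1.sub m2).pow_const 2).aestronglyMeasurable 4
      (Eventually.of_forall fun p => ?_)
    have ha := abs_le.1 (hf.2 p.1)
    have hb := abs_le.1 (hf.2 p.2)
    rw [Real.norm_of_nonneg (sq_nonneg _)]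
    nlinarith
  have hj := (even_two.convexOn_pow (𝕜 := ℝ)).map_integral_le (μ := π)
    (f := fun p : Euc d × Euc d => f p.1 - f p.2) (by fun_prop) isClosed_univ (by simp)
    (i1.sub i2) i3
  rw [e1, e2, ← integral_sub i1 i2, ← ENNReal.ofReal_pow (abs_nonneg _), sq_abs]
  refine (ENNReal.ofReal_le_ofReal hj).trans ?_
  rw [ofReal_integral_eq_lintegral_ofReal i3 (Eventually.of_forall fun p => sq_nonneg _)]
  refine lintegral_mono fun p => ENNReal.ofReal_le_ofReal ?_
  have := hf.1.dist_le_mul p.1 p.2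
  rw [Real.dist_eq] at this
  rw [← sq_abs]
  simp only [NNReal.coe_one, one_mul] at this
  gcongr

lemma evalAt_continuous {d : ℕ} {T : ℝ} (hT : 0 ≤ T) (t : ℝ) :
    Continuous (evalAt hT t : Traj d T → Euc d) := extT_continuous hT t

lemma evalAt_continuous_time {d : ℕ} {T : ℝ} (hT : 0 ≤ T) (γ : Traj d T) :
    Continuous (fun t => evalAt hT t γ) := by
  unfold evalAt
  exact γ.continuous.comp continuous_projIcc

lemma dBL_tendsto {d : ℕ} {T : ℝ} (hT : 0 ≤ T) (Q : Measure (Traj d T))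
    (hQ : IsProbabilityMeasure Q) (t : ℝ) :
    Tendsto (fun s => dBL (Q.map (evalAt hT s)) (Q.map (evalAt hT t))) (𝓝 t) (𝓝 0) := by
  let m : ℝ → ℝ := fun s => ∫ γ, min (dist (evalAt hT s γ) (evalAt hT t γ)) 2 ∂Q
  have hc : ∀ s, Continuous fun γ : Traj d T => min (dist (evalAt hT s γ) (evalAt hT t γ)) 2 :=
    fun s => ((evalAt_continuous hT s).dist (evalAt_continuous hT t)).min continuous_const
  have hb : ∀ s (γ : Traj d T), ‖min (dist (evalAt hT s γ) (evalAt hT t γ)) 2‖ ≤ 2 := fun s γ => by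
    rw [Real.norm_of_nonneg (le_min dist_nonneg (by norm_num))]
    exact min_le_right _ _
  have hm : Tendsto m (𝓝 t) (𝓝 0) := by
    have := tendsto_integral_filter_of_dominated_convergence (μ := Q) (l := 𝓝 t)
      (F := fun s γ => min (dist (evalAt hT s γ) (evalAt hT t γ)) 2)
      (f := fun _ => (0 : ℝ)) (fun _ => 2)
      (Eventually.of_forall fun s => (hc s).measurable.aestronglyMeasurable)
      (Eventually.of_forall fun s => Eventually.of_forall fun γ => hb s γ)
      (integrable_const _) (Eventually.of_forall fun γ => ?_)
    · simpa using this
    · have h1 : Continuous fun s => min (dist (evalAt hT s γ) (evalAt hT t γ)) 2 :=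
        ((evalAt_continuous_time hT γ).dist continuous_const).min continuous_const
      have := h1.tendsto t
      simpa using this
  have hm' : Tendsto (fun s => ENNReal.ofReal (m s)) (𝓝 t) (𝓝 0) := by
    have := (ENNReal.continuous_ofReal.tendsto 0).comp hm
    simpa [Function.comp_def] using this
  refine tendsto_of_tendsto_of_tendsto_of_le_of_le tendsto_const_nhds hm' (fun _ => bot_le) ?_
  intro s
  refine iSup₂_le fun f hf => ENNReal.ofReal_le_ofReal ?_
  have hfm := hf.1.continuous.measurable
  rw [integral_map (evalAt_continuous hT s).measurable.aemeasurable hfm.aestronglyMeasurable,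
    integral_map (evalAt_continuous hT t).measurable.aemeasurable hfm.aestronglyMeasurable]
  have hi : ∀ s, Integrable (fun γ => f (evalAt hT s γ)) Q := fun s =>
    Integrable.of_bound (hf.1.continuous.comp (evalAt_continuous hT s)).measurable.aestronglyMeasurable
      1 (Eventually.of_forall fun γ => hf.2 _)
  rw [← integral_sub (hi s) (hi t)]
  refine (abs_integral_le_integral_abs).trans ?_
  refine integral_mono ((hi s).sub (hi t)).abs
    (Integrable.of_bound (hc s).measurable.aestronglyMeasurable 2
      (Eventually.of_forall fun γ => hb s γ)) fun γ => ?_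
  refine le_min ?_ ?_
  · have := hf.1.dist_le_mul (evalAt hT s γ) (evalAt hT t γ)
    simpa [Real.dist_eq] using this
  · refine (abs_sub _ _).trans ?_
    linarith [hf.2 (evalAt hT s γ), hf.2 (evalAt hT t γ)]

/-- Measurable surrogate of the Moreau envelope. -/
noncomputable def mor' {d : ℕ} (Ω : Set (Euc d)) (F : Measure (Euc d) → ℝ≥0∞) (ε : ℝ)
    (μ : Measure (Euc d)) : ℝ≥0∞ :=
  ⨅ (ρ : Measure (Euc d)) (_ : IsProbabilityMeasure ρ ∧ ρ Ωᶜ = 0),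
    dBL μ ρ ^ 2 / ENNReal.ofReal (2 * ε) + F ρ

lemma mor'_le {d : ℕ} (Ω : Set (Euc d)) (F : Measure (Euc d) → ℝ≥0∞) (ε : ℝ)
    (μ : Measure (Euc d)) (hμ : IsProbabilityMeasure μ) : mor' Ω F ε μ ≤ moreau Ω F ε μ := by
  unfold mor' moreau
  refine iInf₂_mono fun ρ _ => ?_
  gcongr
  exact dBL_sq_le μ ρ hμ

lemma mor'_measurable {d : ℕ} {T : ℝ} (hT : 0 ≤ T) (Q : Measure (Traj d T))
    (hQ : IsProbabilityMeasure Q) (Ω : Set (Euc d)) (F : Measure (Euc d) → ℝ≥0∞) (ε : ℝ)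
    (hε : 0 < ε) : Measurable (fun t => mor' Ω F ε (Q.map (evalAt hT t))) := by
  refine UpperSemicontinuous.measurable ?_
  unfold mor'
  refine upperSemicontinuous_iInf fun ρ => upperSemicontinuous_iInf fun _ => ?_
  intro t y hy
  have h1 : Tendsto (fun s => (dBL (Q.map (evalAt hT s)) (Q.map (evalAt hT t))
      + dBL (Q.map (evalAt hT t)) ρ) ^ 2 / ENNReal.ofReal (2 * ε) + F ρ) (𝓝 t)
      (𝓝 ((0 + dBL (Q.map (evalAt hT t)) ρ) ^ 2 / ENNReal.ofReal (2 * ε) + F ρ)) := by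
    have hc : Continuous fun x : ℝ≥0∞ => (x + dBL (Q.map (evalAt hT t)) ρ) ^ 2 / ENNReal.ofReal (2 * ε) + F ρ := by
      have h0 : Continuous fun x : ℝ≥0∞ => (x + dBL (Q.map (evalAt hT t)) ρ) ^ 2 :=
        (ENNReal.continuous_pow 2).comp (continuous_id.add continuous_const)
      exact ((ENNReal.continuous_div_const _ (by simp [hε])).comp h0).add continuous_const
    exact (hc.tendsto 0).comp (dBL_tendsto hT Q hQ t)
  rw [zero_add] at h1
  filter_upwards [h1.eventually (gt_mem_nhds hy)] with s hs
  refine lt_of_le_of_lt ?_ hs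
  gcongr
  exact dBL_triangle _ _ _

lemma mor'_liminf {d : ℕ} (Ω : Set (Euc d)) (F : Measure (Euc d) → ℝ≥0∞)
    (hFlsc : ∀ (ρ : ℕ → Measure (Euc d)) (σ : Measure (Euc d)),
      (∀ n, IsFiniteMeasure (ρ n)) → IsFiniteMeasure σ → NarrowTendsto ρ σ →
      F σ ≤ liminf (fun n => F (ρ n)) atTop)
    (ε : ℕ → ℝ) (hεpos : ∀ N, 0 < ε N) (hεlim : Tendsto ε atTop (𝓝 0))
    (μ : ℕ → Measure (Euc d)) (ν : Measure (Euc d)) (hμ : ∀ n, IsProbabilityMeasure (μ n))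
    (hν : IsProbabilityMeasure ν) (hcv : NarrowTendsto μ ν) :
    F ν ≤ liminf (fun n => mor' Ω F (ε n) (μ n)) atTop := by
  by_contra hlt
  rw [not_le] at hlt
  obtain ⟨b, hb1, hb2⟩ := exists_between hlt
  have hfr := frequently_lt_of_liminf_lt (by isBoundedDefault) hb1
  obtain ⟨φ, hφ, hφb⟩ := Filter.extraction_of_frequently_atTop hfr
  have hch : ∀ k, ∃ ρ : Measure (Euc d), IsProbabilityMeasure ρ ∧
      dBL (μ (φ k)) ρ ^ 2 / ENNReal.ofReal (2 * ε (φ k)) + F ρ < b := by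
    intro k
    have := hφb k
    unfold mor' at this
    simp only [iInf_lt_iff] at this
    obtain ⟨ρ, h1, h2⟩ := this
    exact ⟨ρ, h1.1, h2⟩
  choose ρ hρ hρb using hch
  have hbtop : b ≠ ⊤ := ne_top_of_lt hb2
  have hnar : NarrowTendsto ρ ν := by
    rw [narrow_iff ρ ν hρ hν, tendsto_iff_forall_lipschitz_integral_tendsto]
    rintro f ⟨B, hB⟩ ⟨K, hK⟩
    change Tendsto (fun k => ∫ x, f x ∂(ρ k)) atTop (𝓝 (∫ x, f x ∂ν))
    have hbd : ∀ x, |f x| ≤ |f 0| + |B| := fun x => by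
      have h1 := (hB x 0).trans (le_abs_self B)
      rw [Real.dist_eq] at h1
      have h2 := abs_add_le (f x - f 0) (f 0)
      rw [sub_add_cancel] at h2
      linarith
    let fb : BoundedContinuousFunction (Euc d) ℝ :=
      BoundedContinuousFunction.ofNormedAddCommGroup f hK.continuous (|f 0| + |B|) hbd
    have hμf : Tendsto (fun k => ∫ x, f x ∂(μ (φ k))) atTop (𝓝 (∫ x, f x ∂ν)) :=
      (hcv fb).comp hφ.tendsto_atTop
    set c : ℝ := K + |f 0| + |B| + 1 with hc
    have hK0 : (0:ℝ) ≤ K := K.2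
    have hcpos : 0 < c := by positivity
    have hcl : LipschitzWith 1 (fun x => c⁻¹ * f x) ∧ ∀ x, |c⁻¹ * f x| ≤ 1 := by
      refine ⟨LipschitzWith.of_dist_le_mul fun x y => ?_, fun x => ?_⟩
      · rw [Real.dist_eq, ← mul_sub, abs_mul, abs_of_pos (inv_pos.2 hcpos), ← Real.dist_eq,
          inv_mul_le_iff₀ hcpos]
        refine (hK.dist_le_mul x y).trans ?_
        rw [NNReal.coe_one, one_mul]
        gcongr
        have := abs_nonneg (f 0); have := abs_nonneg B; linarith
      · rw [abs_mul, abs_of_pos (inv_pos.2 hcpos), inv_mul_le_iff₀ hcpos]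
        have := hbd x; linarith
    have hx : ∀ k, |(∫ x, f x ∂(ρ k)) - ∫ x, f x ∂(μ (φ k))| ≤
        c * Real.sqrt (b.toReal * (2 * ε (φ k))) := by
      intro k
      have h1 := le_dBL (μ (φ k)) (ρ k) _ hcl
      rw [integral_const_mul, integral_const_mul, ← mul_sub, abs_mul,
        abs_of_pos (inv_pos.2 hcpos)] at h1
      have hεk : 0 < 2 * ε (φ k) := by linarith [hεpos (φ k)]
      have h2 : dBL (μ (φ k)) (ρ k) ^ 2 ≤ b * ENNReal.ofReal (2 * ε (φ k)) := by
        rw [← ENNReal.div_le_iff (by simpa using hεpos (φ k)) ENNReal.ofReal_ne_top]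
        exact le_self_add.trans (hρb k).le
      have h3 := (ENNReal.pow_le_pow_left (n := 2) h1).trans h2
      rw [← ENNReal.ofReal_toReal hbtop, ← ENNReal.ofReal_mul ENNReal.toReal_nonneg,
        ← ENNReal.ofReal_pow (by positivity), ENNReal.ofReal_le_ofReal_iff (by positivity)] at h3
      have h4 := Real.le_sqrt_of_sq_le h3
      rw [inv_mul_le_iff₀ hcpos] at h4
      rwa [abs_sub_comm]
    have hz : Tendsto (fun k => c * Real.sqrt (b.toReal * (2 * ε (φ k)))) atTop (𝓝 0) := by
      have h1 : Continuous fun x : ℝ => c * Real.sqrt (b.toReal * (2 * x)) := by fun_prop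
      have := (h1.tendsto 0).comp (hεlim.comp hφ.tendsto_atTop)
      simpa [Function.comp_def] using this
    have hdiff : Tendsto (fun k => (∫ x, f x ∂(ρ k)) - ∫ x, f x ∂(μ (φ k))) atTop (𝓝 0) :=
      squeeze_zero_norm (fun k => hx k) hz
    simpa using hdiff.add hμf
  have h1 := hFlsc ρ ν (fun n => inferInstance) inferInstance hnar
  have h2 : liminf (fun n => F (ρ n)) atTop ≤ b := by
    have : liminf (fun n => F (ρ n)) atTop ≤ liminf (fun _ : ℕ => b) atTop :=
      liminf_le_liminf (Eventually.of_forall fun k => le_add_self.trans (hρb k).le)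
    simpa using this
  exact absurd hb2 (not_lt.2 (h1.trans h2))

lemma narrow_eval {d : ℕ} {T : ℝ} (hT : 0 ≤ T) (Q : ℕ → Measure (Traj d T))
    (Qlim : Measure (Traj d T)) (hQcv : NarrowTendsto Q Qlim) (t : ℝ) :
    NarrowTendsto (fun n => (Q n).map (evalAt hT t)) (Qlim.map (evalAt hT t)) := by
  intro f
  have h : ∀ R : Measure (Traj d T), ∫ x, f x ∂(R.map (evalAt hT t)) = ∫ γ, f (evalAt hT t γ) ∂ R :=
    fun R => integral_map (evalAt_continuous hT t).measurable.aemeasurable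
      f.continuous.measurable.aestronglyMeasurable
  simp_rw [h]
  exact hQcv (f.compContinuous ⟨_, evalAt_continuous hT t⟩)

lemma moreau_part {d : ℕ} {T : ℝ} (hT : 0 ≤ T) (Ω : Set (Euc d)) (F : Measure (Euc d) → ℝ≥0∞)
    (hFlsc : ∀ (ρ : ℕ → Measure (Euc d)) (σ : Measure (Euc d)),
      (∀ n, IsFiniteMeasure (ρ n)) → IsFiniteMeasure σ → NarrowTendsto ρ σ →
      F σ ≤ liminf (fun n => F (ρ n)) atTop)
    (ε : ℕ → ℝ) (hεpos : ∀ N, 0 < ε N) (hεlim : Tendsto ε atTop (𝓝 0))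
    (Q : ℕ → Measure (Traj d T)) (hQ : ∀ N, IsProbabilityMeasure (Q N))
    (Qlim : Measure (Traj d T)) (hQlim : IsProbabilityMeasure Qlim)
    (hQcv : NarrowTendsto Q Qlim) :
    ∫⁻ t in Set.Ioc (0:ℝ) T, F (Qlim.map (evalAt hT t)) ≤
      liminf (fun N => ∫⁻ t in Set.Ioc (0:ℝ) T, moreau Ω F (ε N) ((Q N).map (evalAt hT t))) atTop := by
  have hp : ∀ (R : Measure (Traj d T)), IsProbabilityMeasure R → ∀ t,
      IsProbabilityMeasure (R.map (evalAt hT t)) := fun R _ t =>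
    Measure.isProbabilityMeasure_map (evalAt_continuous hT t).measurable.aemeasurable
  calc _ ≤ ∫⁻ t in Set.Ioc (0:ℝ) T,
        liminf (fun N => mor' Ω F (ε N) ((Q N).map (evalAt hT t))) atTop :=
        lintegral_mono fun t => mor'_liminf Ω F hFlsc ε hεpos hεlim _ _ (fun n => hp _ (hQ n) t)
          (hp _ hQlim t) (narrow_eval hT Q Qlim hQcv t)
    _ ≤ liminf (fun N => ∫⁻ t in Set.Ioc (0:ℝ) T, mor' Ω F (ε N) ((Q N).map (evalAt hT t))) atTop :=
        lintegral_liminf_le fun N => mor'_measurable hT (Q N) (hQ N) Ω F (ε N) (hεpos N)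
    _ ≤ _ := liminf_le_liminf (Eventually.of_forall fun N => lintegral_mono fun t =>
        mor'_le Ω F (ε N) _ (hp _ (hQ N) t))

lemma coe_liminf (a : ℝ≥0∞) (u : ℕ → ℝ≥0∞) (h : a ≤ liminf u atTop) :
    (a : EReal) ≤ liminf (fun n => (u n : EReal)) atTop := by
  have h1 := Monotone.map_liminf_of_continuousAt (F := (atTop : Filter ℕ))
    (f := fun x : ℝ≥0∞ => (x : EReal)) (fun x y hxy => EReal.coe_ennreal_le_coe_ennreal_iff.2 hxy) u
    continuous_coe_ennreal_ereal.continuousAt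
  refine le_trans (EReal.coe_ennreal_le_coe_ennreal_iff.2 h) ?_
  exact h1.le

/-- **Lower bound.** If `ε_N → 0`, `μ⁰_N → μ⁰` narrowly, and `Q_N → Q_∞`
narrowly in `P(Γ)`, then `J(Q_∞) ≤ liminf_N J_{ε_N}(Q_N)`. -/
theorem gamma_lower_bound
    (d : ℕ) (T : ℝ) (hT : 0 < T)
    (Ω : Set (Euc d)) (hΩc : IsCompact Ω) (hΩmeas : MeasurableSet Ω) (hΩne : Ω.Nonempty)
    (r C : ℝ) (hr : 1 < r) (hC : 0 < C)
    (L : Euc d → ℝ) (hLconv : ConvexOn ℝ Set.univ L) (hLcont : Continuous L)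
    (hLgrow : ∀ p : Euc d, 1 / (r * C) * ‖p‖ ^ r - C ≤ L p ∧ L p ≤ C / r * ‖p‖ ^ r + C)
    (F : Measure (Euc d) → ℝ≥0∞)
    (hFconv : ∀ ρ σ : Measure (Euc d), ∀ a b : ℝ≥0∞, a + b = 1 →
      F (a • ρ + b • σ) ≤ a * F ρ + b * F σ)
    (hFlsc : ∀ (ρ : ℕ → Measure (Euc d)) (σ : Measure (Euc d)),
      (∀ n, IsFiniteMeasure (ρ n)) → IsFiniteMeasure σ → NarrowTendsto ρ σ →
      F σ ≤ liminf (fun n => F (ρ n)) atTop)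
    (hFsupp : ∀ ρ : Measure (Euc d), F ρ ≠ ⊤ → ρ Ωᶜ = 0)
    (G : Measure (Traj d T) → ℝ)
    (hGcont : ∀ (Q : ℕ → Measure (Traj d T)) (Q' : Measure (Traj d T)),
      (∀ n, IsProbabilityMeasure (Q n)) → IsProbabilityMeasure Q' →
      NarrowTendsto Q Q' → Tendsto (fun n => G (Q n)) atTop (𝓝 (G Q')))
    (hGbdd : BddBelow (Set.range G))
    (ε : ℕ → ℝ) (hεpos : ∀ N, 0 < ε N) (hεlim : Tendsto ε atTop (𝓝 0))
    (μ0 : Measure (Euc d)) (hμ0 : IsProbabilityMeasure μ0)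
    (μ0N : ℕ → Measure (Euc d)) (hμ0N : ∀ N, IsProbabilityMeasure (μ0N N))
    (hμ0Ncv : NarrowTendsto μ0N μ0)
    (Q : ℕ → Measure (Traj d T)) (hQ : ∀ N, IsProbabilityMeasure (Q N))
    (Qlim : Measure (Traj d T)) (hQlim : IsProbabilityMeasure Qlim)
    (hQcv : NarrowTendsto Q Qlim) :
    Jfun hT.le L C F G Qlim ≤ liminf (fun N => Jeps hT.le Ω L C F G (ε N) (Q N)) atTop := by
  have hL : ∀ p : Euc d, 1 / (r * C) * ‖p‖ ^ r ≤ L p + C := fun p => by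
    have := (hLgrow p).1; linarith
  have hK := coe_liminf _ _ (action_liminf hT L r C hr hC hLconv hLcont hL Q hQ Qlim hQlim hQcv)
  have hF := coe_liminf _ _
    (moreau_part hT.le Ω F hFlsc ε hεpos hεlim Q hQ Qlim hQlim hQcv)
  have hG := hGcont Q Qlim hQ hQlim hQcv
  have hG' : Tendsto (fun N => ((G (Q N) : ℝ) : EReal)) atTop (𝓝 ((G Qlim : ℝ) : EReal)) :=
    (continuous_coe_real_ereal.tendsto _).comp hG
  unfold Jfun Jeps kinE
  simp only [sub_eq_add_neg]
  refine le_trans ?_ EReal.le_liminf_add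
  refine add_le_add ?_ hG'.liminf_eq.ge
  refine le_trans ?_ EReal.le_liminf_add
  refine add_le_add ?_ hF
  refine le_trans ?_ EReal.le_liminf_add
  refine add_le_add hK ?_
  simp
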